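/- arXiv:2410.03474 — 4 statements merged into one kernel-verified Lean document; each statement's English description precedes it below -/
import Mathlib

section
/- Suppose there are n agents, each agent i authoring m_i papers, with m_i · k_p ≤ k_a for every agent i and n ≥ k_p + 1 (where k_p ≥ 1 is the number of reviews each paper must receive and k_a is the maximum number of papers an agent may review), and suppose each agent i has, for each of her submissions p_{i,ℓ}, a strict ranking σ_{i,ℓ} over the other agents. Then there exists a valid assignment R such that, for every choice of per-submission set preferences (total preorders ≽_{i,ℓ} over k_p-element subsets of N∖{i} whose strict parts ≻_{i,ℓ} are order separable with respect to σ_{i,ℓ}) and every choice of per-agent preferences over assignments (total preorders ≽_i, with strict parts ≻_i, that are consistent with the per-submission preferences), the assignment R is in the core: there is no subset N' ⊆ N, subsets P'_i ⊆ P_i for each i ∈ N', and valid restricted assignment R̂ over N' and P' = ∪_{i∈N'} P'_i such that R̂ ≻_i R for every i ∈ N'. -/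
/-!
Model: there are `n` agents (type `Fin n`); agent `i` authors `m i` papers,
so the papers are the sigma type `Σ i, Fin (m i)`.  An assignment maps each
paper to the finite set of agents reviewing it.
-/

/-- The type of papers: paper `⟨i, ℓ⟩` is the `ℓ`-th submission of agent `i`. -/
abbrev Paper (n : ℕ) (m : Fin n → ℕ) := Σ i : Fin n, Fin (m i)

/-- An assignment maps each paper to the set of agents assigned to review it. -/
abbrev Assign (n : ℕ) (m : Fin n → ℕ) := Paper n m → Finset (Fin n)

/-- A valid (full) reviewing assignment: each paper gets exactly `kp` reviewers,
each agent reviews at most `ka` papers, and nobody reviews her own papers. -/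
def ValidAssignment (n : ℕ) (m : Fin n → ℕ) (kp ka : ℕ) (R : Assign n m) : Prop :=
  (∀ p : Paper n m, (R p).card = kp) ∧
  (∀ i : Fin n, ((Finset.univ : Finset (Paper n m)).filter (fun p => i ∈ R p)).card ≤ ka) ∧
  (∀ p : Paper n m, p.1 ∉ R p)

/-- A valid restricted assignment over agents `N'` and papers `P' = ⋃_{i ∈ N'} P'_i`:
each such paper gets exactly `kp` reviewers from `N'`, no agent reviews her own
paper, and each agent of `N'` reviews at most `ka` of these papers. -/
def ValidRestricted (n : ℕ) (m : Fin n → ℕ) (kp ka : ℕ)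
    (N' : Finset (Fin n)) (P' : ∀ i : Fin n, Finset (Fin (m i))) (R : Assign n m) : Prop :=
  (∀ p : Paper n m, p.1 ∈ N' → p.2 ∈ P' p.1 →
      (R p).card = kp ∧ R p ⊆ N' ∧ p.1 ∉ R p) ∧
  (∀ i ∈ N',
      ((Finset.univ : Finset (Paper n m)).filter
        (fun p => p.1 ∈ N' ∧ p.2 ∈ P' p.1 ∧ i ∈ R p)).card ≤ ka)

/-- Order separability of a strict set-preference (over `kp`-element subsets of the
agents other than `i`) with respect to the ranking `σ` (smaller position = better):
for pairwise disjoint `S₁, S₂, S₃` avoiding `i` with `|S₁| = |S₂| > 0` and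
`|S₁ ∪ S₃| = kp`, if every member of `S₁` is ranked above every member of `S₂`,
then `S₁ ∪ S₃` is strictly preferred to `S₂ ∪ S₃`. -/
def OrderSeparable (n kp : ℕ) (i : Fin n) (σ : Fin n → ℕ)
    (sprefer : Finset (Fin n) → Finset (Fin n) → Prop) : Prop :=
  ∀ S1 S2 S3 : Finset (Fin n),
    i ∉ S1 → i ∉ S2 → i ∉ S3 →
    Disjoint S1 S2 → Disjoint S1 S3 → Disjoint S2 S3 →
    S1.card = S2.card → 0 < S1.card → S1.card + S3.card = kp →
    (∀ a ∈ S1, ∀ b ∈ S2, σ a < σ b) →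
    sprefer (S1 ∪ S3) (S2 ∪ S3)

/-- `w` is a total preorder on the part of `α` satisfying `D`. -/
def TotalPreorderOn {α : Sort*} (D : α → Prop) (w : α → α → Prop) : Prop :=
  (∀ a, D a → w a a) ∧
  (∀ a b c, D a → D b → D c → w a b → w b c → w a c) ∧
  (∀ a b, D a → D b → w a b ∨ w b a)

/-- The strict part of a weak preference relation. -/
def strictPart {α : Sort*} (w : α → α → Prop) (a b : α) : Prop := w a b ∧ ¬ w b a

/-- From agent `i`'s point of view, a (possibly restricted) assignment is described by
the reviewer sets of all papers together with the set of `i`'s papers that are present. -/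
abbrev View (n : ℕ) (m : Fin n → ℕ) (i : Fin n) := Assign n m × Finset (Fin (m i))

/-- Consistency of agent `i`'s preference `wag` over assignments with her
per-submission weak preferences `wsub`: if `i` weakly prefers (submission-wise)
the reviewer set under `R` to the one under `R̂` for every one of her papers present
in the restricted assignment `R̂`, then she weakly prefers `R` to `R̂` overall. -/
def Consistent (n : ℕ) (m : Fin n → ℕ) (i : Fin n)
    (wsub : Fin (m i) → Finset (Fin n) → Finset (Fin n) → Prop)
    (wag : View n m i → View n m i → Prop) : Prop :=
  ∀ (R Rhat : Assign n m) (P'i : Finset (Fin (m i))),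
    (∀ ℓ ∈ P'i, wsub ℓ (R ⟨i, ℓ⟩) (Rhat ⟨i, ℓ⟩)) →
    wag (R, (Finset.univ : Finset (Fin (m i)))) (Rhat, P'i)

/-- A Gale-type criterion: a cut condition guarantees sets `F q` of size `k` lying between
prescribed bounds `G q` and `H q` such that every element belongs to at most `c` of them. -/
theorem exists_between_card_eq {α β : Type*} [Fintype α] [Fintype β] [DecidableEq α]
    [DecidableEq β] (G H : α → Finset β) (k c : ℕ) (hGH : ∀ q, G q ⊆ H q)
    (hG : ∀ q, (G q).card ≤ k)
    (hcut : ∀ (B : Finset α) (Z : Finset β),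
      ∑ q ∈ B, ((k : ℤ) - (H q \ Z).card) + ∑ q ∈ Bᶜ, ((G q ∩ Z).card : ℤ) ≤ Z.card * c) :
    ∃ F : α → Finset β, (∀ q, G q ⊆ F q ∧ F q ⊆ H q ∧ (F q).card = k) ∧
      ∀ u, (Finset.univ.filter fun q => u ∈ F q).card ≤ c := by
  classical
  have hH : ∀ q, k ≤ (H q).card := by
    intro q
    have h1 := hcut {q} ∅
    simp at h1
    exact h1
  let load : β → ℕ := fun u => (Finset.univ.filter fun q => u ∈ G q).card
  have load_sum : ∀ Z : Finset β, ∑ u ∈ Z, load u = ∑ q, (G q ∩ Z).card := by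
    intro Z
    have := Finset.sum_card_bipartiteAbove_eq_sum_card_bipartiteBelow (s := Z)
      (t := (Finset.univ : Finset α)) (fun u q => u ∈ G q)
    simp only [Finset.bipartiteAbove, Finset.bipartiteBelow] at this
    rw [this]
    refine Finset.sum_congr rfl fun q _ => ?_
    congr 1; ext u; simp [and_comm]
  have hload : ∀ u, load u ≤ c := by
    intro u
    have h1 := hcut ∅ {u}
    have h2 := load_sum {u}
    simp only [Finset.sum_singleton] at h2
    simp at h1
    rw [h2]
    exact_mod_cast h1
  let E := {e : α × β // e.2 ∈ H e.1 \ G e.1}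
  let A : Finset α → Finset (Σ _ : α, ℕ) := fun B => B.sigma fun q => Finset.range ((H q).card - k)
  let C : Finset β → Finset (Σ _ : β, ℕ) := fun Z => Z.sigma fun u => Finset.range (c - load u)
  let t : E → Finset ((Σ _ : α, ℕ) ⊕ (Σ _ : β, ℕ)) := fun e => (A {e.1.1}).disjSum (C {e.1.2})
  obtain ⟨f, hf, hft⟩ := (Finset.all_card_le_biUnion_card_iff_exists_injective t).1 (by
    intro s
    set B := s.image fun e => e.1.1 with hB
    set Z := s.image fun e => e.1.2 with hZ
    have hU : s.biUnion t = (A B).disjSum (C Z) := by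
      ext x
      rcases x with ⟨q, i⟩ | ⟨u, i⟩ <;>
        simp only [t, A, C, hB, hZ, Finset.mem_biUnion, Finset.inl_mem_disjSum,
          Finset.inr_mem_disjSum, Finset.mem_sigma, Finset.mem_singleton, Finset.mem_image] <;>
        grind
    have h1 : s.card ≤ ∑ q ∈ B, ((H q \ G q) ∩ Z).card := by
      rw [← Finset.card_sigma]
      refine Finset.card_le_card_of_injOn (fun e => ⟨e.1.1, e.1.2⟩) ?_ ?_
      · intro e he
        have he' : e ∈ s := he
        simp only [Finset.coe_sigma, Set.mem_sigma_iff, Finset.mem_coe, Finset.mem_inter]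
        exact ⟨Finset.mem_image_of_mem (fun e : E => e.1.1) he', e.2,
          Finset.mem_image_of_mem (fun e : E => e.1.2) he'⟩
      · intro e _ e' _ h
        simp only [Sigma.mk.injEq, heq_eq_eq] at h
        exact Subtype.ext (Prod.ext h.1 h.2)
    rw [hU, Finset.card_disjSum, Finset.card_sigma, Finset.card_sigma]
    simp only [Finset.card_range]
    have h2 := hcut B Z
    have h3 : ∀ q, ((H q).card : ℤ) =
        (H q \ Z).card + ((H q \ G q) ∩ Z).card + (G q ∩ Z).card := by
      intro q
      have e1 := Finset.card_sdiff_add_card_inter (H q) Z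
      have e2 := Finset.card_sdiff_add_card_inter (H q ∩ Z) (G q)
      have e3 : (H q ∩ Z) \ G q = (H q \ G q) ∩ Z := by ext; grind
      have e4 : (H q ∩ Z) ∩ G q = G q ∩ Z := by
        ext x; have := @hGH q x; grind
      rw [e3, e4] at e2
      omega
    have h4 : (∑ u ∈ Z, (load u : ℤ)) =
        ∑ q ∈ B, ((G q ∩ Z).card : ℤ) + ∑ q ∈ Bᶜ, ((G q ∩ Z).card : ℤ) := by
      rw [Finset.sum_add_sum_compl]
      exact_mod_cast load_sum Z
    have h5 : ((∑ q ∈ B, ((H q).card - k) : ℕ) : ℤ) = ∑ q ∈ B, (((H q).card : ℤ) - k) := by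
      push_cast [hH]; rfl
    have h6 : ((∑ u ∈ Z, (c - load u) : ℕ) : ℤ) = Z.card * c - ∑ u ∈ Z, (load u : ℤ) := by
      push_cast [hload]
      simp
    have h7 : ∑ q ∈ B, (((H q).card : ℤ) - k) = - ∑ q ∈ B, ((k : ℤ) - (H q \ Z).card) +
        ∑ q ∈ B, (((H q \ G q) ∩ Z).card : ℤ) + ∑ q ∈ B, ((G q ∩ Z).card : ℤ) := by
      rw [← Finset.sum_neg_distrib, ← Finset.sum_add_distrib, ← Finset.sum_add_distrib]
      exact Finset.sum_congr rfl fun q _ => by rw [h3 q]; ring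
    zify at h1 ⊢
    zify at h5 h6
    linarith)
  let used : α → Finset β := fun q =>
    (H q).filter fun u => ∃ h : u ∈ H q \ G q, (f ⟨(q, u), h⟩).isRight
  have hused : ∀ q, k ≤ (G q ∪ used q).card := by
    intro q
    have h1 : (H q \ (G q ∪ used q)).card ≤ (H q).card - k := by
      have hc : ((A {q}).map Function.Embedding.inl : Finset (_ ⊕ (Σ _ : β, ℕ))).card =
          (H q).card - k := by
        simp [A]
      rw [← hc]
      refine Finset.card_le_card_of_injOn
        (fun u => if h : u ∈ H q \ G q then f ⟨(q, u), h⟩ else Sum.inl ⟨q, 0⟩) ?_ ?_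
      · intro u hu
        have hu' : u ∈ H q \ G q := by
          have : u ∈ H q \ (G q ∪ used q) := hu
          grind
        have hnr : ¬ (f ⟨(q, u), hu'⟩).isRight := by
          intro hr
          have : u ∈ H q \ (G q ∪ used q) := hu
          have h := Finset.mem_sdiff.1 this
          exact h.2 (Finset.mem_union_right _ (Finset.mem_filter.2 ⟨h.1, hu', hr⟩))
        have hm := hft ⟨(q, u), hu'⟩
        simp only [hu', dite_true]
        rcases hx : f ⟨(q, u), hu'⟩ with ⟨q', i⟩ | y
        · rw [hx] at hm
          simp [t, A] at hm
          obtain ⟨rfl, hi⟩ := hm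
          simpa [A] using hi
        · simp [hx] at hnr
      · intro u hu v hv h
        have hu' : u ∈ H q \ G q := by
          have : u ∈ H q \ (G q ∪ used q) := hu
          grind
        have hv' : v ∈ H q \ G q := by
          have : v ∈ H q \ (G q ∪ used q) := hv
          grind
        simp only [hu', hv', dite_true] at h
        exact congrArg (fun e : E => e.1.2) (hf h)
    have h2 : G q ∪ used q ⊆ H q := Finset.union_subset (hGH q) (Finset.filter_subset _ _)
    rw [Finset.card_sdiff_of_subset h2] at h1
    have := Finset.card_le_card h2
    have := hH q
    omega
  choose F hF1 hF2 hF3 using fun q =>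
    Finset.exists_subsuperset_card_eq (Finset.subset_union_left (s₁ := G q) (s₂ := used q))
      (hG q) (hused q)
  refine ⟨F, fun q => ⟨hF1 q, (hF2 q).trans
    (Finset.union_subset (hGH q) (Finset.filter_subset _ _)), hF3 q⟩, fun u => ?_⟩
  have h1 : (Finset.univ.filter fun q => u ∈ F q) ⊆
      (Finset.univ.filter fun q => u ∈ G q) ∪ (Finset.univ.filter fun q => u ∈ used q) := by
    intro q hq
    have := @hF2 q u
    grind
  have h2 : (Finset.univ.filter fun q => u ∈ used q).card ≤ c - load u := by
    have hc : ((C {u}).map Function.Embedding.inr : Finset ((Σ _ : α, ℕ) ⊕ _)).card =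
        c - load u := by
      simp [C]
    rw [← hc]
    refine Finset.card_le_card_of_injOn
      (fun q => if h : u ∈ H q \ G q then f ⟨(q, u), h⟩ else Sum.inr ⟨u, 0⟩) ?_ ?_
    · intro q hq
      simp only [used, Finset.coe_filter, Finset.mem_univ, true_and, Set.mem_ofPred_eq,
        Finset.mem_filter] at hq
      obtain ⟨-, hu', hr⟩ := hq
      have hm := hft ⟨(q, u), hu'⟩
      simp only [hu', dite_true]
      rcases hx : f ⟨(q, u), hu'⟩ with y | ⟨u', i⟩
      · simp [hx] at hr
      · rw [hx] at hm
        simp [t, C] at hm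
        obtain ⟨rfl, hi⟩ := hm
        simpa [C] using hi
    · intro q hq q' hq' h
      simp only [used, Finset.coe_filter, Finset.mem_univ, true_and, Set.mem_ofPred_eq,
        Finset.mem_filter] at hq hq'
      obtain ⟨-, hu, -⟩ := hq
      obtain ⟨-, hu', -⟩ := hq'
      simp only [hu, hu', dite_true] at h
      exact congrArg (fun e : E => e.1.1) (hf h)
  have h3 := (Finset.card_le_card h1).trans (Finset.card_union_le _ _)
  have := hload u
  have h4 : (Finset.univ.filter fun q => u ∈ G q).card = load u := rfl
  omega

theorem card_filter_author (n : ℕ) (m : Fin n → ℕ) (u : Fin n) :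
    ((Finset.univ : Finset (Paper n m)).filter fun p => p.1 = u).card = m u := by
  have h : ((Finset.univ : Finset (Paper n m)).filter fun p => p.1 = u) =
      (Finset.univ : Finset (Fin (m u))).map ⟨Sigma.mk u, sigma_mk_injective⟩ := by
    ext ⟨a, ℓ⟩
    simp only [Finset.mem_filter, Finset.mem_univ, true_and, Finset.mem_map,
      Function.Embedding.coeFn_mk]
    constructor
    · rintro rfl
      exact ⟨ℓ, rfl⟩
    · rintro ⟨ℓ', h⟩
      exact (congrArg Sigma.fst h).symm
  rw [h, Finset.card_map, Finset.card_fin]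

/-- A partial assignment `T` that is complete outside `L`, where `L` consists of `kp` agents,
extends to a valid assignment that leaves the papers of agents outside `L ∪ {j}` unchanged and
changes the papers of `j` only by replacing reviewers outside `L` with reviewers in `L`. -/
theorem exists_filling (n kp ka : ℕ) (m : Fin n → ℕ) (hkp : 1 ≤ kp)
    (hm : ∀ i, m i * kp ≤ ka) (L : Finset (Fin n)) (hL : L.card = kp) (j : Fin n) (hj : j ∉ L)
    (T : Assign n m) (hauth : ∀ p, p.1 ∉ T p) (hcard : ∀ p : Paper n m, p.1 ∉ L → (T p).card = kp)
    (hload : ∀ u, (Finset.univ.filter fun p => u ∈ T p).card ≤ ka) :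
    ∃ R : Assign n m, ValidAssignment n m kp ka R ∧
      (∀ p : Paper n m, p.1 ∉ L → p.1 ≠ j → R p = T p) ∧
      (∀ p : Paper n m, p.1 = j → T p ∩ L ⊆ R p ∧ R p ⊆ T p ∪ L) := by
  classical
  let G : Assign n m := fun p => if p.1 ∈ L then ∅ else if p.1 = j then T p ∩ L else T p
  let H : Assign n m := fun p =>
    if p.1 ∈ L then Finset.univ.erase p.1 else if p.1 = j then T p ∪ L else T p
  have hLsum : ∀ h : Fin n → ℕ, (∀ w, h w * kp ≤ ka) → ∑ w ∈ L, h w ≤ ka := by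
    intro h hh
    have h1 : (∑ w ∈ L, h w) * kp ≤ kp * ka := by
      rw [Finset.sum_mul, ← hL, ← smul_eq_mul (L.card)]
      exact Finset.sum_le_card_nsmul _ _ _ fun w _ => hL ▸ hh w
    rw [mul_comm kp] at h1
    exact Nat.le_of_mul_le_mul_right h1 hkp
  obtain ⟨F, hF, hFload⟩ := exists_between_card_eq G H kp ka
    (by intro p; simp only [G, H]; split_ifs <;> grind)
    (by
      intro p
      simp only [G]
      split_ifs with h1 h2
      · simp
      · exact hL ▸ Finset.card_le_card Finset.inter_subset_right
      · exact (hcard p h1).le)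
    (by
      intro B Z
      have hZ : ((Zᶜ : Finset (Fin n)).card : ℤ) = n - Z.card := by
        have := Finset.card_add_card_compl Z
        simp only [Fintype.card_fin] at this
        omega
      have hcost : ∀ g : Paper n m → ℤ,
          (∀ p, (kp : ℤ) - (H p \ Z).card ≤ g p) → (∀ p, ((G p ∩ Z).card : ℤ) ≤ g p) →
          ∑ q ∈ B, ((kp : ℤ) - (H q \ Z).card) + ∑ q ∈ Bᶜ, ((G q ∩ Z).card : ℤ) ≤ ∑ p, g p := by
        intro g h1 h2
        rw [← Finset.sum_add_sum_compl B g]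
        exact add_le_add (Finset.sum_le_sum fun p _ => h1 p) (Finset.sum_le_sum fun p _ => h2 p)
      have hT : ∀ p : Paper n m, p.1 ∉ L → ((T p \ Z).card : ℤ) + (T p ∩ Z).card = kp := by
        intro p hp
        exact_mod_cast (Finset.card_sdiff_add_card_inter _ _).trans (hcard p hp)
      have hLZ : ((L \ Z).card : ℤ) + (L ∩ Z).card = kp := by
        exact_mod_cast (Finset.card_sdiff_add_card_inter _ _).trans hL
      have herase : ∀ a, (((Finset.univ.erase a) \ Z).card : ℤ) =
          n - Z.card - if a ∈ Z then 0 else 1 := by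
        intro a
        have e : (Finset.univ.erase a) \ Z = Zᶜ.erase a := by ext x; simp
        rw [e, ← hZ]
        split_ifs with h
        · rw [Finset.erase_eq_of_notMem (by simpa using h)]; simp
        · have h' : a ∈ Zᶜ := by simpa using h
          have := Finset.card_erase_add_one h'
          omega
      rcases le_or_gt (n : ℤ) (kp + Z.card) with hbig | hsmall
      · let g : Fin n → ℤ := fun a => if a ∈ L then kp - n + Z.card + (if a ∈ Z then 0 else 1) else
          if a = j then ((L ∩ Z).card : ℤ) else kp
        have hsum : ∑ p : Paper n m, g p.1 = ∑ a, (m a : ℤ) * g a := by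
          rw [Fintype.sum_sigma]
          simp
        refine (hcost (fun p => g p.1) ?_ ?_).trans ?_
        · intro p
          simp only [H, g]
          split_ifs with h1 h2 h3
          · have := herase p.1; simp only [h2, if_true] at this; omega
          · have := herase p.1; simp only [h2, if_false] at this; omega
          · have := Finset.card_le_card (Finset.sdiff_subset_sdiff
              (Finset.subset_union_right (s₁ := T p) (s₂ := L)) (le_refl Z))
            omega
          · omega
        · intro p
          simp only [G, g]
          split_ifs with h1 h2 h3
          · simp; omega
          · simp; omega
          · exact_mod_cast Finset.card_le_card
              (Finset.inter_subset_inter_right Finset.inter_subset_right)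
          · have := hT p h1; omega
        · rw [hsum, ← Finset.sum_add_sum_compl (insert j L), Finset.sum_insert hj]
          have e1 : ∑ w ∈ (insert j L)ᶜ, (m w : ℤ) * g w ≤ (n - kp - 1) * ka := by
            have : (((insert j L)ᶜ : Finset (Fin n)).card : ℤ) = n - kp - 1 := by
              have h1 := Finset.card_add_card_compl (insert j L)
              rw [Finset.card_insert_of_notMem hj] at h1
              simp only [Fintype.card_fin] at h1
              omega
            rw [← this, ← nsmul_eq_mul]
            refine Finset.sum_le_card_nsmul _ _ _ fun w hw => ?_
            simp only [Finset.mem_compl, Finset.mem_insert, not_or] at hw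
            simp only [g, hw.1, hw.2, if_false]
            exact_mod_cast hm w
          have e2 : ∑ w ∈ L, (m w : ℤ) * g w =
              (kp - n + Z.card) * (∑ w ∈ L, (m w : ℤ)) +
                ∑ w ∈ L, (if w ∈ Z then 0 else (m w : ℤ)) := by
            rw [Finset.mul_sum, ← Finset.sum_add_distrib]
            refine Finset.sum_congr rfl fun w hw => ?_
            simp only [g, hw, if_true]
            split_ifs <;> ring
          have e3 : (m j : ℤ) * (L ∩ Z).card = ∑ w ∈ L, (if w ∈ Z then (m j : ℤ) else 0) := by
            rw [← Finset.sum_filter, Finset.sum_const, nsmul_eq_mul, mul_comm,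
              Finset.filter_mem_eq_inter]
          have e4 : ∑ w ∈ L, (if w ∈ Z then (m j : ℤ) else 0) +
              ∑ w ∈ L, (if w ∈ Z then 0 else (m w : ℤ)) ≤ ka := by
            have := hLsum (fun w => if w ∈ Z then m j else m w)
              (fun w => by split_ifs <;> apply hm)
            rw [← Finset.sum_add_distrib]
            refine le_of_eq_of_le ?_ ((Nat.cast_le (α := ℤ)).2 this)
            push_cast
            exact Finset.sum_congr rfl fun w _ => by split_ifs <;> simp
          have e5 : ∑ w ∈ L, (m w : ℤ) ≤ ka := by exact_mod_cast hLsum m hm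
          have e6 : ((kp : ℤ) - n + Z.card) * (∑ w ∈ L, (m w : ℤ)) ≤ (kp - n + Z.card) * ka :=
            mul_le_mul_of_nonneg_left e5 (by omega)
          have e7 : g j = (L ∩ Z).card := by simp [g, hj]
          rw [e2, e7, e3]
          linarith
      · refine (hcost (fun p => (T p ∩ Z).card) ?_ ?_).trans ?_
        · intro p
          simp only [H]
          split_ifs with h1 h2
          · have := herase p.1
            split_ifs at this <;> omega
          · have := hT p h1
            have := Finset.card_le_card (Finset.sdiff_subset_sdiff
              (Finset.subset_union_left (s₁ := T p) (s₂ := L)) (le_refl Z))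
            omega
          · have := hT p h1
            omega
        · intro p
          refine Nat.cast_le.2 (Finset.card_le_card (Finset.inter_subset_inter_right ?_))
          simp only [G]
          split_ifs
          · simp
          · exact Finset.inter_subset_left
          · rfl
        · have h1 := Finset.sum_card_bipartiteAbove_eq_sum_card_bipartiteBelow (s := Z)
            (t := (Finset.univ : Finset (Paper n m))) (fun u q => u ∈ T q)
          simp only [Finset.bipartiteAbove, Finset.bipartiteBelow] at h1
          have h2 : ∀ p, (T p ∩ Z).card = (Z.filter fun u => u ∈ T p).card := by
            intro p
            rw [Finset.filter_mem_eq_inter, Finset.inter_comm]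
          simp only [h2]
          rw [← Nat.cast_sum, ← h1, ← nsmul_eq_mul, ← Nat.cast_smul_eq_nsmul ℤ]
          have := Finset.sum_le_card_nsmul Z _ _ fun u _ => hload u
          simpa using (Nat.cast_le (α := ℤ)).2 this)
  refine ⟨F, ⟨fun p => (hF p).2.2, hFload, fun p hp => ?_⟩, fun p hp hpj => ?_, fun p hp => ?_⟩
  · have h1 := (hF p).2.1 hp
    have h2 := hauth p
    simp only [H] at h1
    split_ifs at h1 with h3 h4 <;> grind
  · have h1 := hF p
    simp only [G, H, hp, hpj, if_false] at h1
    exact h1.2.1.antisymm h1.1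
  · have h1 := hF p
    have h2 : p.1 ∉ L := hp ▸ hj
    simp only [G, H, if_neg h2, if_pos hp] at h1
    exact ⟨h1.1, h1.2.1⟩

theorem nonempty_periodicPts {α : Type*} [Finite α] [Nonempty α] (f : α → α) :
    (Function.periodicPts f).Nonempty := by
  obtain ⟨x⟩ := ‹Nonempty α›
  obtain ⟨i, j, hij, h⟩ : ∃ i j, i < j ∧ f^[i] x = f^[j] x := by
    obtain ⟨i, j, hij, h⟩ := Finite.exists_ne_map_eq_of_infinite fun i => f^[i] x
    rcases hij.lt_or_gt with hij | hij
    · exact ⟨i, j, hij, h⟩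
    · exact ⟨j, i, hij, h.symm⟩
  refine ⟨f^[i] x, Function.mk_mem_periodicPts (Nat.sub_pos_of_lt hij) ?_⟩
  rw [Function.IsPeriodicPt, Function.IsFixedPt, ← Function.iterate_add_apply,
    Nat.sub_add_cancel hij.le, h]

/-- The invariants of a partial assignment `T` reached by top trading cycles in which the agents
of `A` are still active. -/
structure IsTradingState {n : ℕ} {m : Fin n → ℕ} (kp : ℕ)
    (σ : ∀ i : Fin n, Fin (m i) → Fin n → ℕ) (A : Finset (Fin n)) (T : Assign n m) : Prop where
  card_le : ∀ p, (T p).card ≤ kp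
  author : ∀ p, p.1 ∉ T p
  load : ∀ u, (Finset.univ.filter fun p => u ∈ T p).card ≤
    ∑ p ∈ Finset.univ.filter (fun p : Paper n m => p.1 = u), (T p).card
  active : ∀ p, p.1 ∈ A → ∀ x ∈ T p, ∀ y ∈ A, y ≠ p.1 → y ∉ T p → σ p.1 p.2 x < σ p.1 p.2 y
  removed : ∀ N' : Finset (Fin n), ¬ N' ⊆ A → ∃ a ∈ N', a ∉ A ∧ ∀ p : Paper n m, p.1 = a →
    (T p).card = kp ∧ ∀ x ∈ T p, ∀ y ∈ N', y ≠ a → y ∉ T p → σ p.1 p.2 x < σ p.1 p.2 y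

namespace IsTradingState

variable {n kp : ℕ} {m : Fin n → ℕ} {σ : ∀ i : Fin n, Fin (m i) → Fin n → ℕ}
  {A : Finset (Fin n)} {T : Assign n m}

theorem load_le {ka : ℕ} (h : IsTradingState kp σ A T) (hm : ∀ i, m i * kp ≤ ka) (u : Fin n) :
    (Finset.univ.filter fun p => u ∈ T p).card ≤ ka := by
  refine (h.load u).trans ((Finset.sum_le_card_nsmul _ _ kp fun p _ => h.card_le p).trans ?_)
  rw [card_filter_author, smul_eq_mul]
  exact hm u

theorem card_eq_of_author_notMem (h : IsTradingState kp σ A T) (p : Paper n m) (hp : p.1 ∉ A) :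
    (T p).card = kp := by
  obtain ⟨a, ha, -, h1⟩ := h.removed {p.1} (by simpa using hp)
  exact (h1 p (Finset.mem_singleton.1 ha).symm).1

/-- While no active agent is complete, executing a trading cycle makes progress. -/
theorem exists_sum_card_lt
    (hσ : ∀ (i : Fin n) (ℓ : Fin (m i)) (a b : Fin n),
      a ≠ i → b ≠ i → σ i ℓ a = σ i ℓ b → a = b)
    (h : IsTradingState kp σ A T) (hA : kp + 1 ≤ A.card)
    (hinc : ∀ a ∈ A, ∃ p : Paper n m, p.1 = a ∧ (T p).card ≠ kp) :
    ∃ T' : Assign n m, IsTradingState kp σ A T' ∧ ∑ p, (T p).card < ∑ p, (T' p).card := by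
  classical
  have hpoint : ∀ a : A, ∃ (p : Paper n m) (b : A), p.1 = a ∧ (T p).card < kp ∧ (b : Fin n) ≠ a ∧
      (b : Fin n) ∉ T p ∧
      ∀ y ∈ A, y ≠ p.1 → y ∉ T p → y ≠ b → σ p.1 p.2 b < σ p.1 p.2 y := by
    rintro ⟨a, ha⟩
    obtain ⟨p, rfl, hp⟩ := hinc a ha
    have hlt := lt_of_le_of_ne (h.card_le p) hp
    have hne : (A.erase p.1 \ T p).Nonempty := by
      rw [← Finset.card_pos]
      have h1 := Finset.le_card_sdiff (T p) (A.erase p.1)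
      have h2 := Finset.card_erase_add_one ha
      omega
    obtain ⟨b, hb, hmin⟩ := Finset.exists_min_image _ (σ p.1 p.2) hne
    simp only [Finset.mem_sdiff, Finset.mem_erase] at hb hmin
    refine ⟨p, ⟨b, hb.1.2⟩, rfl, hlt, hb.1.1, hb.2, fun y hy hy1 hy2 hy3 => ?_⟩
    exact lt_of_le_of_ne (hmin y ⟨⟨hy1, hy⟩, hy2⟩) fun e => hy3 (hσ _ _ _ _ hb.1.1 hy1 e).symm
  choose q f hq hcard hne hnot hmin using hpoint
  have hqinj : ∀ c c', q c = q c' → c = c' := fun c c' e =>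
    Subtype.ext ((hq c).symm.trans ((congrArg Sigma.fst e).trans (hq c')))
  let C : Set A := Function.periodicPts f
  have hCinj : Set.InjOn f C := (Function.bijOn_periodicPts f).injOn
  have hCmaps : Set.MapsTo f C C := (Function.bijOn_periodicPts f).mapsTo
  obtain ⟨c₀, hc₀⟩ : C.Nonempty := by
    have : Nonempty A := (Finset.card_pos.1 (by omega : 0 < A.card)).to_subtype
    exact nonempty_periodicPts f
  let T' : Assign n m := fun p =>
    T p ∪ Finset.univ.filter fun x => ∃ c ∈ C, q c = p ∧ (f c : Fin n) = x
  have hT1 : ∀ c ∈ C, T' (q c) = insert (f c : Fin n) (T (q c)) := by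
    intro c hc
    ext x
    simp only [T', Finset.mem_union, Finset.mem_filter, Finset.mem_univ, true_and,
      Finset.mem_insert]
    constructor
    · rintro (hx | ⟨c', -, e, rfl⟩)
      · exact .inr hx
      · exact .inl (by rw [hqinj _ _ e])
    · rintro (rfl | hx)
      · exact .inr ⟨c, hc, rfl, rfl⟩
      · exact .inl hx
  have hT2 : ∀ p, (¬ ∃ c ∈ C, q c = p) → T' p = T p := by
    intro p hp
    ext x
    simp only [T', Finset.mem_union, Finset.mem_filter, Finset.mem_univ, true_and]
    exact ⟨fun hx => hx.elim id fun ⟨c, hc, e, _⟩ => (hp ⟨c, hc, e⟩).elim, .inl⟩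
  have hTle : ∀ p, (T p).card ≤ (T' p).card := fun p =>
    Finset.card_le_card Finset.subset_union_left
  have hTlt : ∀ c ∈ C, (T (q c)).card < (T' (q c)).card := by
    intro c hc
    rw [hT1 c hc, Finset.card_insert_of_notMem (hnot c)]
    exact Nat.lt_succ_self _
  refine ⟨T', ⟨fun p => ?_, fun p => ?_, fun u => ?_, fun p hp x hx y hy hyp hyT => ?_,
    fun N' hN' => ?_⟩, Finset.sum_lt_sum (fun p _ => hTle p) ⟨q c₀, Finset.mem_univ _, hTlt c₀ hc₀⟩⟩
  · by_cases hp : ∃ c ∈ C, q c = p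
    · obtain ⟨c, hc, rfl⟩ := hp
      rw [hT1 c hc, Finset.card_insert_of_notMem (hnot c)]
      exact hcard c
    · exact hT2 p hp ▸ h.card_le p
  · by_cases hp : ∃ c ∈ C, q c = p
    · obtain ⟨c, hc, rfl⟩ := hp
      rw [hT1 c hc, Finset.mem_insert, not_or]
      exact ⟨fun e => hne c (e.symm.trans (hq c)), h.author _⟩
    · exact hT2 p hp ▸ h.author p
  · by_cases hu : ∃ c ∈ C, (f c : Fin n) = u
    · obtain ⟨c, hc, rfl⟩ := hu
      have h1 : (Finset.univ.filter fun p => (f c : Fin n) ∈ T' p) ⊆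
          insert (q c) (Finset.univ.filter fun p => (f c : Fin n) ∈ T p) := by
        intro p hp
        simp only [T', Finset.mem_filter, Finset.mem_univ, true_and, Finset.mem_union,
          Finset.mem_insert] at hp ⊢
        rcases hp with hp | ⟨c', hc', rfl, e⟩
        · exact .inr hp
        · exact .inl (by rw [hCinj hc' hc (Subtype.ext e)])
      have h2 : ∑ p ∈ Finset.univ.filter (fun p : Paper n m => p.1 = f c), (T p).card <
          ∑ p ∈ Finset.univ.filter (fun p : Paper n m => p.1 = f c), (T' p).card :=
        Finset.sum_lt_sum (fun p _ => hTle p)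
          ⟨q (f c), by simpa using hq (f c), hTlt _ (hCmaps hc)⟩
      have h3 := (Finset.card_le_card h1).trans (Finset.card_insert_le _ _)
      have h4 := h.load (f c)
      omega
    · have h1 : (Finset.univ.filter fun p => u ∈ T' p) ⊆ Finset.univ.filter fun p => u ∈ T p := by
        intro p hp
        simp only [T', Finset.mem_filter, Finset.mem_univ, true_and, Finset.mem_union] at hp ⊢
        exact hp.elim id fun ⟨c, hc, _, e⟩ => (hu ⟨c, hc, e⟩).elim
      exact (Finset.card_le_card h1).trans ((h.load u).trans (Finset.sum_le_sum fun p _ => hTle p))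
  · by_cases hpC : ∃ c ∈ C, q c = p
    · obtain ⟨c, hc, rfl⟩ := hpC
      rw [hT1 c hc, Finset.mem_insert] at hx hyT
      push Not at hyT
      rcases hx with rfl | hx
      · exact hmin c y hy hyp hyT.2 hyT.1
      · exact h.active _ hp x hx y hy hyp hyT.2
    · rw [hT2 p hpC] at hx hyT
      exact h.active p hp x hx y hy hyp hyT
  · obtain ⟨a, ha, haA, h1⟩ := h.removed N' hN'
    refine ⟨a, ha, haA, fun p hp => ?_⟩
    rw [hT2 p]
    · exact h1 p hp
    · rintro ⟨c, -, rfl⟩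
      exact haA (hp ▸ hq c ▸ c.2)

/-- Trading cycles can be executed until some active agent is complete. -/
theorem exists_complete
    (hσ : ∀ (i : Fin n) (ℓ : Fin (m i)) (a b : Fin n),
      a ≠ i → b ≠ i → σ i ℓ a = σ i ℓ b → a = b)
    (h : IsTradingState kp σ A T) (hA : kp + 1 ≤ A.card) :
    ∃ T' : Assign n m, IsTradingState kp σ A T' ∧
      ∃ a ∈ A, ∀ p : Paper n m, p.1 = a → (T' p).card = kp := by
  induction hd : Fintype.card (Paper n m) * kp - ∑ p, (T p).card using Nat.strong_induction_on
    generalizing T with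
  | _ d ih =>
    by_cases hc : ∃ a ∈ A, ∀ p : Paper n m, p.1 = a → (T p).card = kp
    · exact ⟨T, h, hc⟩
    · push Not at hc
      obtain ⟨T', h', hlt⟩ := h.exists_sum_card_lt hσ hA hc
      have hle : ∑ p, (T' p).card ≤ Fintype.card (Paper n m) * kp :=
        Finset.sum_le_card_nsmul _ _ kp fun p _ => h'.card_le p
      exact ih _ (by omega) h' rfl

/-- A complete agent can be deactivated. -/
theorem erase (h : IsTradingState kp σ A T) {j : Fin n} (hj : j ∈ A)
    (hcomplete : ∀ p : Paper n m, p.1 = j → (T p).card = kp) :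
    IsTradingState kp σ (A.erase j) T where
  card_le := h.card_le
  author := h.author
  load := h.load
  active p hp x hx y hy :=
    h.active p (Finset.mem_of_mem_erase hp) x hx y (Finset.mem_of_mem_erase hy)
  removed N' hN' := by
    by_cases hA : N' ⊆ A
    · have hjN : j ∈ N' := by
        by_contra hjN
        exact hN' (Finset.subset_erase.2 ⟨hA, hjN⟩)
      refine ⟨j, hjN, Finset.notMem_erase _ _, fun p hp =>
        ⟨hcomplete p hp, fun x hx y hy hyj => ?_⟩⟩
      subst hp
      exact h.active p hj x hx y (hA hy) hyj
    · obtain ⟨a, ha, haA, h1⟩ := h.removed N' hA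
      exact ⟨a, ha, fun h2 => haA (Finset.mem_of_mem_erase h2), h1⟩

theorem univ_empty : IsTradingState kp σ Finset.univ (fun _ => ∅ : Assign n m) where
  card_le p := by simp
  author p := by simp
  load u := by simp
  active p _ x hx := by simp at hx
  removed N' hN' := (hN' (Finset.subset_univ _)).elim

/-- Starting from the empty assignment, trading can be continued until any prescribed number of
active agents greater than `kp` is left. -/
theorem exists_card_eq
    (hσ : ∀ (i : Fin n) (ℓ : Fin (m i)) (a b : Fin n),
      a ≠ i → b ≠ i → σ i ℓ a = σ i ℓ b → a = b)
    {k : ℕ} (hkn : k ≤ n) (hk : kp + 1 ≤ k) :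
    ∃ (A : Finset (Fin n)) (T : Assign n m), IsTradingState kp σ A T ∧ A.card = k := by
  induction hkn using Nat.decreasingInduction with
  | self => exact ⟨Finset.univ, _, univ_empty, by simp⟩
  | of_succ k hkn ih =>
    obtain ⟨A, T, h, hA⟩ := ih (by omega)
    obtain ⟨T', h', j, hj, hcomplete⟩ := h.exists_complete hσ (by omega)
    exact ⟨A.erase j, T', h'.erase hj hcomplete, by rw [Finset.card_erase_of_mem hj, hA]; rfl⟩

end IsTradingState

/-- A set that dominates another one of the same size elementwise is weakly preferred. -/
theorem wsub_of_forall_lt {n kp : ℕ} {i : Fin n} {σ : Fin n → ℕ}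
    {w : Finset (Fin n) → Finset (Fin n) → Prop}
    (hw : TotalPreorderOn (fun S : Finset (Fin n) => S.card = kp ∧ i ∉ S) w)
    (hsep : OrderSeparable n kp i σ (strictPart w)) {S S' : Finset (Fin n)}
    (hS : S.card = kp) (hS' : S'.card = kp) (hi : i ∉ S) (hi' : i ∉ S')
    (hlt : ∀ x ∈ S, ∀ y ∈ S', x ∉ S' → y ∉ S → σ x < σ y) : w S S' := by
  by_cases he : S = S'
  · exact he ▸ hw.1 S ⟨hS, hi⟩
  · have h1 := Finset.card_sdiff_add_card_inter S S'
    have h2 := Finset.card_sdiff_add_card_inter S' S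
    rw [Finset.inter_comm] at h2
    have hpos : 0 < (S \ S').card := by
      rw [Finset.card_pos, Finset.sdiff_nonempty]
      exact fun hsub => he (Finset.eq_of_subset_of_card_le hsub (by omega))
    have h := (hsep (S \ S') (S' \ S) (S ∩ S') (by grind) (by grind) (by grind)
      disjoint_sdiff_sdiff (Finset.disjoint_sdiff_inter S S')
      (Finset.inter_comm S S' ▸ Finset.disjoint_sdiff_inter S' S) (by omega) hpos (by omega)
      (by
        intro x hx y hy
        rw [Finset.mem_sdiff] at hx hy
        exact hlt x hx.1 y hy.1 hx.2 hy.2)).1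
    rwa [Finset.sdiff_union_inter, Finset.inter_comm, Finset.sdiff_union_inter] at h

/-- Under the stated conditions there is a valid assignment `R`
that is in the core with respect to every choice of order-separable per-submission
preferences and consistent per-agent preferences: no community `N'` with papers
`P'` can deviate to a valid restricted assignment that every member strictly prefers. -/
theorem exists_core_assignment
    (n kp ka : ℕ) (m : Fin n → ℕ)
    (hkp : 1 ≤ kp) (hn : kp + 1 ≤ n) (hm : ∀ i : Fin n, m i * kp ≤ ka)
    (σ : ∀ i : Fin n, Fin (m i) → Fin n → ℕ)
    (hσ : ∀ (i : Fin n) (ℓ : Fin (m i)) (a b : Fin n),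
        a ≠ i → b ≠ i → σ i ℓ a = σ i ℓ b → a = b) :
    ∃ R : Assign n m, ValidAssignment n m kp ka R ∧
      ∀ (wsub : ∀ i : Fin n, Fin (m i) → Finset (Fin n) → Finset (Fin n) → Prop)
        (wag : ∀ i : Fin n, View n m i → View n m i → Prop),
        (∀ (i : Fin n) (ℓ : Fin (m i)),
            TotalPreorderOn (fun S : Finset (Fin n) => S.card = kp ∧ i ∉ S) (wsub i ℓ)) →
        (∀ (i : Fin n) (ℓ : Fin (m i)),
            OrderSeparable n kp i (σ i ℓ) (strictPart (wsub i ℓ))) →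
        (∀ i : Fin n, TotalPreorderOn (fun _ => True) (wag i)) →
        (∀ i : Fin n, Consistent n m i (wsub i) (wag i)) →
        ¬ ∃ (N' : Finset (Fin n)) (P' : ∀ i : Fin n, Finset (Fin (m i)))
            (Rhat : Assign n m),
            N'.Nonempty ∧ ValidRestricted n m kp ka N' P' Rhat ∧
            ∀ i ∈ N',
              strictPart (wag i) (Rhat, P' i) (R, (Finset.univ : Finset (Fin (m i)))) := by
  obtain ⟨W, T₀, h₀, hW⟩ := IsTradingState.exists_card_eq hσ hn le_rfl
  obtain ⟨T, h, j, hj, hcomplete⟩ := h₀.exists_complete hσ hW.ge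
  have hcard : ∀ p : Paper n m, p.1 ∉ W.erase j → (T p).card = kp := by
    intro p hp
    by_cases hpj : p.1 = j
    · exact hcomplete p hpj
    · exact h.card_eq_of_author_notMem p fun hpW => hp (Finset.mem_erase.2 ⟨hpj, hpW⟩)
  obtain ⟨R, hR, hRT, hRj⟩ := exists_filling n kp ka m hkp hm (W.erase j)
    (by rw [Finset.card_erase_of_mem hj, hW]; rfl) j (Finset.notMem_erase _ _) T h.author hcard
    (h.load_le hm)
  refine ⟨R, hR, fun wsub wag hwsub hsep _ hcons => ?_⟩
  rintro ⟨N', P', Rhat, ⟨i, hi⟩, ⟨hRhat, -⟩, hdev⟩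
  suffices hex : ∃ a ∈ N', ∀ ℓ ∈ P' a, ∀ x ∈ R ⟨a, ℓ⟩, ∀ y ∈ Rhat ⟨a, ℓ⟩,
      x ∉ Rhat ⟨a, ℓ⟩ → y ∉ R ⟨a, ℓ⟩ → σ a ℓ x < σ a ℓ y by
    obtain ⟨a, ha, hlt⟩ := hex
    refine (hdev a ha).2 (hcons a R Rhat (P' a) fun ℓ hℓ => ?_)
    obtain ⟨h1, -, h2⟩ := hRhat ⟨a, ℓ⟩ ha hℓ
    exact wsub_of_forall_lt (hwsub a ℓ) (hsep a ℓ) (hR.1 _) h1 (hR.2.2 ⟨a, ℓ⟩) h2 (hlt ℓ hℓ)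
  by_cases hN : N' ⊆ W
  · by_cases hP : P' i = ∅
    · exact ⟨i, hi, by simp [hP]⟩
    · obtain ⟨ℓ₀, hℓ₀⟩ := Finset.nonempty_iff_ne_empty.2 hP
      obtain ⟨h1, h2, h3⟩ := hRhat ⟨i, ℓ₀⟩ hi hℓ₀
      have h4 := Finset.card_le_card (Finset.subset_erase.2 ⟨h2, h3⟩)
      have h5 := Finset.card_erase_add_one hi
      obtain rfl : N' = W := Finset.eq_of_subset_of_card_le hN (by grind)
      refine ⟨j, hj, fun ℓ hℓ x hx y hy hxR hyR => ?_⟩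
      obtain ⟨h6, h7, h8⟩ := hRhat ⟨j, ℓ⟩ hj hℓ
      obtain ⟨h9, h10⟩ := hRj ⟨j, ℓ⟩ rfl
      have hsub : Rhat ⟨j, ℓ⟩ ⊆ N'.erase j := Finset.subset_erase.2 ⟨h7, h8⟩
      have heq : Rhat ⟨j, ℓ⟩ = N'.erase j :=
        Finset.eq_of_subset_of_card_le hsub (by grind)
      have hxT : x ∈ T ⟨j, ℓ⟩ := (Finset.mem_union.1 (h10 hx)).resolve_right (heq ▸ hxR)
      have hyT : y ∉ T ⟨j, ℓ⟩ := fun hyT => hyR (h9 (Finset.mem_inter.2 ⟨hyT, hsub hy⟩))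
      exact h.active ⟨j, ℓ⟩ hj x hxT y (h7 hy) (Finset.ne_of_mem_erase (hsub hy)) hyT
  · obtain ⟨a, ha, haW, hlt⟩ := h.removed N' hN
    refine ⟨a, ha, fun ℓ hℓ x hx y hy _ hyR => ?_⟩
    obtain ⟨-, h1, h2⟩ := hRhat ⟨a, ℓ⟩ ha hℓ
    rw [hRT ⟨a, ℓ⟩ (fun h3 => haW (Finset.mem_of_mem_erase h3))
      fun h3 : a = j => haW (h3 ▸ hj)] at hx hyR
    exact (hlt ⟨a, ℓ⟩ rfl).2 x hx y (h1 hy) (fun h3 => h2 (h3 ▸ hy)) hyR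
end

section
/- Suppose there are n agents, each agent i authoring m_i papers, with m_i · k_p ≤ k_a for every agent i and n ≥ k_p + 1, and suppose each agent i has, for each of her submissions p_{i,ℓ}, an injective nonnegative similarity score function u_{i,ℓ} : N∖{i} → ℝ≥0 over potential reviewers. Then there exists a valid assignment R such that there is no subset N' ⊆ N, subsets P'_i ⊆ P_i for each i ∈ N', and valid restricted assignment R̂ over N' and P' = ∪_{i∈N'} P'_i with the property that Σ_{p_{i,ℓ} ∈ P'_i} Σ_{r ∈ R̂^p_{p_{i,ℓ}}} u_{i,ℓ}(r) > Σ_{p_{i,ℓ} ∈ P_i} Σ_{r ∈ R^p_{p_{i,ℓ}}} u_{i,ℓ}(r) for every agent i ∈ N'. -/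
namespace CoreAssignment

open Finset

variable {n : ℕ} {m : Fin n → ℕ}

/-- The number of papers agent `a` reviews in `R`. -/
def load (R : Assign n m) (a : Fin n) : ℕ := ∑ p, if a ∈ R p then 1 else 0

/-- The number of reviews the papers of agent `a` receive in `R`. -/
def received (R : Assign n m) (a : Fin n) : ℕ := ∑ l : Fin (m a), #(R ⟨a, l⟩)

/-- The total number of reviews in `R`. -/
def size (R : Assign n m) : ℕ := ∑ p, #(R p)

lemma sum_load (R : Assign n m) : ∑ a, load R a = size R := by
  simp only [load, size]
  rw [sum_comm]
  simp

lemma load_update (R : Assign n m) (q : Paper n m) (s : Finset (Fin n)) (a : Fin n) :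
    load (Function.update R q s) a + (if a ∈ R q then 1 else 0) =
      load R a + (if a ∈ s then 1 else 0) := by
  unfold load
  rw [← add_sum_erase _ _ (mem_univ q), ← add_sum_erase _ _ (mem_univ q)]
  have : ∑ p ∈ univ.erase q, (if a ∈ Function.update R q s p then 1 else 0) =
      ∑ p ∈ univ.erase q, if a ∈ R p then 1 else 0 :=
    sum_congr rfl fun p hp => by rw [Function.update_of_ne (ne_of_mem_erase hp)]
  rw [this, Function.update_self]
  omega

lemma size_update (R : Assign n m) (q : Paper n m) (s : Finset (Fin n)) :
    size (Function.update R q s) + #(R q) = size R + #s := by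
  unfold size
  rw [← add_sum_erase _ _ (mem_univ q), ← add_sum_erase _ _ (mem_univ q)]
  have : ∑ p ∈ univ.erase q, #(Function.update R q s p) = ∑ p ∈ univ.erase q, #(R p) :=
    sum_congr rfl fun p hp => by rw [Function.update_of_ne (ne_of_mem_erase hp)]
  rw [this, Function.update_self]
  omega

lemma size_le {kp : ℕ} {R : Assign n m} (h : ∀ p, #(R p) ≤ kp) :
    size R ≤ Fintype.card (Paper n m) * kp := by
  simpa [size] using sum_le_card_nsmul univ (fun p => #(R p)) kp fun p _ => h p

/-- Assignments obtained from `T` by modifying only papers of agents in `W`, where papers of the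
pivot `l` may only exchange reviewers outside `W` for reviewers in `W`. Agent `a` keeps `δ a`
units of her reviewing load in reserve. -/
structure IsFilling (kp ka : ℕ) (T : Assign n m) (W : Finset (Fin n)) (l : Fin n)
    (δ : Fin n → ℕ) (R : Assign n m) : Prop where
  card_le : ∀ p, #(R p) ≤ kp
  not_own : ∀ p, p.1 ∉ R p
  outside : ∀ p, p.1 ∉ W → R p = T p
  card_pivot : ∀ p, p.1 = l → #(R p) = kp
  pivot_sub : ∀ p, p.1 = l → R p ⊆ T p ∪ W
  pivot_sup : ∀ p, p.1 = l → T p ∩ W ⊆ R p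
  load_out : ∀ a, a ∉ W → load R a + δ a = m a * kp
  load_in : ∀ a, a ∈ W → load R a + δ a ≤ ka

section Filling

variable {kp ka : ℕ} {T : Assign n m} {W : Finset (Fin n)} {l : Fin n} {R : Assign n m}

/-- An agent with a reserved unit replaces a reviewer, who then has a unit in reserve. -/
lemma IsFilling.replace {h x : Fin n} {q : Paper n m}
    (hR : IsFilling kp ka T W l (Pi.single h 1) R) (hqW : q.1 ∈ W)
    (hh : h ∉ R q) (hhq : h ≠ q.1) (hx : x ∈ R q) (hl : q.1 = l → h ∈ W ∧ x ∉ W) :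
    IsFilling kp ka T W l (Pi.single x 1)
      (Function.update R q (insert h ((R q).erase x))) ∧
    size (Function.update R q (insert h ((R q).erase x))) = size R := by
  have hhx : h ≠ x := fun e => hh (e ▸ hx)
  have hcard : #(insert h ((R q).erase x)) = #(R q) := by
    rw [card_insert_of_notMem (fun e => hh (mem_of_mem_erase e)), card_erase_add_one hx]
  have hload : ∀ a, load (Function.update R q (insert h ((R q).erase x))) a +
      (Pi.single x 1 : Fin n → ℕ) a = load R a + (Pi.single h 1 : Fin n → ℕ) a := by
    intro a
    have := load_update R q (insert h ((R q).erase x)) a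
    simp only [Pi.single_apply, mem_insert, mem_erase] at *
    by_cases h1 : a = x
    · subst h1
      simp_all [Ne.symm hhx]
    · by_cases h2 : a = h
      · subst h2
        simp_all
      · simp_all
  refine ⟨⟨?_, ?_, ?_, ?_, ?_, ?_, ?_, ?_⟩, ?_⟩
  · intro p
    by_cases hp : p = q
    · subst hp; rw [Function.update_self, hcard]; exact hR.card_le p
    · rw [Function.update_of_ne hp]; exact hR.card_le p
  · intro p
    by_cases hp : p = q
    · subst hp
      rw [Function.update_self]
      have := hR.not_own p
      simp [hhq.symm, this]
    · rw [Function.update_of_ne hp]; exact hR.not_own p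
  · intro p hpW
    rw [Function.update_of_ne (by rintro rfl; exact hpW hqW)]
    exact hR.outside p hpW
  · intro p hp
    by_cases hpq : p = q
    · subst hpq; rw [Function.update_self, hcard]; exact hR.card_pivot p hp
    · rw [Function.update_of_ne hpq]; exact hR.card_pivot p hp
  · intro p hp
    by_cases hpq : p = q
    · subst hpq
      rw [Function.update_self]
      have := hR.pivot_sub p hp
      exact insert_subset (mem_union_right _ (hl hp).1) ((erase_subset _ _).trans this)
    · rw [Function.update_of_ne hpq]; exact hR.pivot_sub p hp
  · intro p hp
    by_cases hpq : p = q
    · subst hpq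
      rw [Function.update_self]
      intro y hy
      have := hR.pivot_sup p hp hy
      refine mem_insert_of_mem (mem_erase.2 ⟨?_, this⟩)
      rintro rfl
      exact (hl hp).2 (mem_inter.1 hy).2
    · rw [Function.update_of_ne hpq]; exact hR.pivot_sup p hp
  · intro a ha; rw [hload]; exact hR.load_out a ha
  · intro a ha; rw [hload]; exact hR.load_in a ha
  · have := size_update R q (insert h ((R q).erase x))
    omega

/-- An agent with a reserved unit joins the reviewers of an incomplete paper. -/
lemma IsFilling.add {h : Fin n} {q : Paper n m}
    (hR : IsFilling kp ka T W l (Pi.single h 1) R) (hqW : q.1 ∈ W)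
    (hh : h ∉ R q) (hhq : h ≠ q.1) (hq : #(R q) < kp) :
    IsFilling kp ka T W l 0 (Function.update R q (insert h (R q))) ∧
    size R < size (Function.update R q (insert h (R q))) := by
  have hcard : #(insert h (R q)) = #(R q) + 1 := card_insert_of_notMem hh
  have hload : ∀ a, load (Function.update R q (insert h (R q))) a +
      (0 : Fin n → ℕ) a = load R a + (Pi.single h 1 : Fin n → ℕ) a := by
    intro a
    have := load_update R q (insert h (R q)) a
    simp only [Pi.single_apply, mem_insert] at *
    by_cases h2 : a = h
    · subst h2
      simp_all
    · simp_all
  have hql : q.1 ≠ l := fun e => by have := hR.card_pivot q e; omega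
  refine ⟨⟨?_, ?_, ?_, ?_, ?_, ?_, ?_, ?_⟩, ?_⟩
  · intro p
    by_cases hp : p = q
    · subst hp; rw [Function.update_self, hcard]; exact hq
    · rw [Function.update_of_ne hp]; exact hR.card_le p
  · intro p
    by_cases hp : p = q
    · subst hp
      rw [Function.update_self]
      have := hR.not_own p
      simp [hhq.symm, this]
    · rw [Function.update_of_ne hp]; exact hR.not_own p
  · intro p hpW
    rw [Function.update_of_ne (by rintro rfl; exact hpW hqW)]
    exact hR.outside p hpW
  · intro p hp
    rw [Function.update_of_ne (by rintro rfl; exact hql hp)]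
    exact hR.card_pivot p hp
  · intro p hp
    rw [Function.update_of_ne (by rintro rfl; exact hql hp)]
    exact hR.pivot_sub p hp
  · intro p hp
    rw [Function.update_of_ne (by rintro rfl; exact hql hp)]
    exact hR.pivot_sup p hp
  · intro a ha; rw [hload]; exact hR.load_out a ha
  · intro a ha; rw [hload]; exact hR.load_in a ha
  · have := size_update R q (insert h (R q))
    omega

lemma IsFilling.mem_of_maximal {N : ℕ}
    (hmax : ∀ R' : Assign n m, IsFilling kp ka T W l 0 R' → size R' ≤ N) {h : Fin n}
    (hR : IsFilling kp ka T W l (Pi.single h 1) R) (hN : size R = N)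
    {q : Paper n m} (hqW : q.1 ∈ W) (hq : #(R q) < kp) (hhq : h ≠ q.1) : h ∈ R q := by
  by_contra hh
  have := hR.add hqW hh hhq hq
  have := hmax _ this.1
  omega

/-- If a filling of maximal size leaves some paper incomplete, an agent with a reserved unit
reviews every paper of the other agents in `W`, except possibly those of the pivot. -/
lemma IsFilling.mem_of_maximal_of_ne_pivot {N : ℕ}
    (hmax : ∀ R' : Assign n m, IsFilling kp ka T W l 0 R' → size R' ≤ N) {h : Fin n}
    (hR : IsFilling kp ka T W l (Pi.single h 1) R) (hN : size R = N)
    {p q : Paper n m} (hpW : p.1 ∈ W) (hp : #(R p) < kp) (hqW : q.1 ∈ W) (hql : q.1 ≠ l)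
    (hhq : h ≠ q.1) : h ∈ R q := by
  by_contra hh
  have hq : #(R q) = kp := by
    refine le_antisymm (hR.card_le q) (not_lt.1 fun hlt => hh ?_)
    exact hR.mem_of_maximal hmax hN hqW hlt hhq
  have hpq : p ≠ q := by rintro rfl; omega
  have hhp : h ∈ insert p.1 (R p) := by
    by_cases e : h = p.1
    · simp [e]
    · exact mem_insert_of_mem (hR.mem_of_maximal hmax hN hpW hp e)
  obtain ⟨x, hx, hxp⟩ : ∃ x ∈ R q, x ∉ insert p.1 (R p) := by
    by_contra! hsub
    have hle : #(insert p.1 (R p)) ≤ #(R q) := by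
      have := card_insert_le p.1 (R p)
      omega
    exact hh (eq_of_subset_of_card_le hsub hle ▸ hhp)
  have hR' := hR.replace hqW hh hhq hx (fun e => absurd e hql)
  have hmem := hR'.1.mem_of_maximal hmax (hR'.2.trans hN) hpW
    (by rwa [Function.update_of_ne hpq]) (fun e => hxp (e ▸ mem_insert_self _ _))
  rw [Function.update_of_ne hpq] at hmem
  exact hxp (mem_insert_of_mem hmem)

lemma IsFilling.reserve (hR : IsFilling kp ka T W l 0 R) {j : Fin n} (hj : j ∈ W)
    (hlt : load R j < ka) : IsFilling kp ka T W l (Pi.single j 1) R := by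
  refine { hR with load_out := fun a ha => ?_, load_in := fun a ha => ?_ }
  · have := hR.load_out a ha
    rw [Pi.single_eq_of_ne (by rintro rfl; exact ha hj)]
    exact this
  · have := hR.load_in a ha
    by_cases e : a = j
    · subst e; simpa using hlt
    · rw [Pi.single_eq_of_ne e]; exact this

lemma sum_load_on (R : Assign n m) (W Y : Finset (Fin n)) :
    ∑ i ∈ W, ∑ k : Fin (m i), #(R ⟨i, k⟩ ∩ Y) ≤ ∑ a ∈ Y, load R a := by
  have h : ∑ a ∈ Y, load R a = ∑ i, ∑ k : Fin (m i), #(R ⟨i, k⟩ ∩ Y) := by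
    simp only [load]
    rw [sum_comm, Fintype.sum_sigma]
    refine sum_congr rfl fun i _ => sum_congr rfl fun k _ => ?_
    rw [← card_filter, inter_comm, filter_mem_eq_inter]
  rw [h]
  exact sum_le_sum_of_subset (subset_univ W)

lemma sum_load_lt (hR : IsFilling kp ka T W l 0 R) {p : Paper n m} (hp : #(R p) < kp) :
    ∑ a ∈ W, load R a < ∑ i ∈ W, m i * kp := by
  have h1 : size R < ∑ i, m i * kp := by
    have : ∑ i, m i * kp = ∑ _p : Paper n m, kp := by
      simp [sum_mul]
    rw [this]
    exact sum_lt_sum (fun q _ => hR.card_le q) ⟨p, mem_univ _, hp⟩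
  rw [← sum_load, ← sum_add_sum_compl W, ← sum_add_sum_compl W (fun i => m i * kp)] at h1
  have h2 : ∑ a ∈ Wᶜ, load R a = ∑ a ∈ Wᶜ, m a * kp :=
    sum_congr rfl fun a ha => by simpa using hR.load_out a (mem_compl.1 ha)
  omega

/-- A filling of maximal size completes every paper. -/
lemma IsFilling.card_eq_of_maximal (hkp : 1 ≤ kp) (hm : ∀ i, m i * kp ≤ ka)
    (hW : #W = kp + 1) (hl : l ∈ W) (hT : ∀ p, p.1 ∉ W → #(T p) = kp)
    (hR : IsFilling kp ka T W l 0 R)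
    (hmax : ∀ R' : Assign n m, IsFilling kp ka T W l 0 R' → size R' ≤ size R)
    (p : Paper n m) : #(R p) = kp := by
  by_contra hne
  have hp : #(R p) < kp := lt_of_le_of_ne (hR.card_le p) hne
  have hpW : p.1 ∈ W := by
    by_contra h
    exact hne (hR.outside p h ▸ hT p h)
  set S := W.filter (fun a => load R a < ka) with hS
  set F := W.filter (fun a => ¬ load R a < ka) with hF
  set O := univ.filter (fun o => o ∉ W ∧ ∃ q : Paper n m, q.1 = l ∧ o ∈ R q ∧
    ∃ j ∈ S, j ≠ l ∧ j ∉ R q) with hO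
  have hSW : S ⊆ W := filter_subset _ _
  have hSF : #S + #F = kp + 1 := by rw [← hW, hS, hF, card_filter_add_card_filter_not]
  have hSO : Disjoint S O := by
    rw [disjoint_left]
    intro a ha hb
    exact (mem_filter.1 hb).2.1 (hSW ha)
  have hSres : ∀ j ∈ S, IsFilling kp ka T W l (Pi.single j 1) R := fun j hj =>
    hR.reserve (hSW hj) (mem_filter.1 hj).2
  have hSmem : ∀ j ∈ S, ∀ q : Paper n m, q.1 ∈ W → q.1 ≠ l → j ≠ q.1 → j ∈ R q :=
    fun j hj q hqW hql hjq =>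
      (hSres j hj).mem_of_maximal_of_ne_pivot hmax rfl hpW hp hqW hql hjq
  have hpl : p.1 ≠ l := fun e => hne (hR.card_pivot p e)
  have hOmem : ∀ o ∈ O, ∀ q : Paper n m, q.1 ∈ W → q.1 ≠ l → o ∈ R q := by
    intro o ho q hqW hql
    obtain ⟨-, hoW, q', hq'l, hoq', j, hj, hjl, hjq'⟩ := mem_filter.1 ho
    have hq'W : q'.1 ∈ W := hq'l ▸ hl
    have hR' := (hSres j hj).replace hq'W hjq' (hq'l ▸ hjl) hoq' (fun _ => ⟨hSW hj, hoW⟩)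
    have hne' : ∀ r : Paper n m, r.1 ≠ l → r ≠ q' := by
      rintro r hr rfl
      exact hr hq'l
    have := hR'.1.mem_of_maximal_of_ne_pivot hmax hR'.2 hpW
      (by rwa [Function.update_of_ne (hne' p hpl)]) hqW hql (fun e => hoW (e ▸ hqW))
    rwa [Function.update_of_ne (hne' q hql)] at this
  have hcardY : #(S ∪ O) = #S + #O := card_union_of_disjoint hSO
  have hYmem : ∀ q : Paper n m, q.1 ∈ W → q.1 ≠ l → (S ∪ O).erase q.1 ⊆ R q := by
    intro q hqW hql a ha
    obtain ⟨haq, ha⟩ := mem_erase.1 ha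
    rcases mem_union.1 ha with ha | ha
    · exact hSmem a ha q hqW hql haq
    · exact hOmem a ha q hqW hql
  have hSOk : #S + #O ≤ kp := by
    have h1 := card_le_card (hYmem p hpW hpl)
    have h2 := pred_card_le_card_erase (s := S ∪ O) (a := p.1)
    omega
  obtain ⟨e, he⟩ : ∃ e, #F = #O + 1 + e := ⟨#F - #O - 1, by omega⟩
  set w : Fin n → ℕ := fun i => e + (if i ∈ S then 1 else 0) + (if i = l then #O else 0) with hw
  have hpaper : ∀ q : Paper n m, q.1 ∈ W → kp ≤ #(R q ∩ (S ∪ O)) + w q.1 := by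
    intro q hqW
    by_cases hql : q.1 = l
    · by_cases hsub : S.erase l ⊆ R q
      · have h1 : #(S.erase l) ≤ #(R q ∩ (S ∪ O)) := card_le_card fun a ha =>
          mem_inter.2 ⟨hsub ha, mem_union_left _ (mem_of_mem_erase ha)⟩
        simp only [hw, hql, if_true]
        rw [card_erase_eq_ite] at h1
        split_ifs at * <;> omega
      · obtain ⟨j, hj, hjq⟩ := not_subset.1 hsub
        obtain ⟨hjl, hjS⟩ := mem_erase.1 hj
        have h1 : R q ⊆ (R q ∩ (S ∪ O)) ∪ F.erase l := by
          intro a ha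
          by_cases haY : a ∈ S ∪ O
          · exact mem_union_left _ (mem_inter.2 ⟨ha, haY⟩)
          · refine mem_union_right _ (mem_erase.2 ⟨?_, ?_⟩)
            · rintro rfl
              exact hR.not_own q (hql ▸ ha)
            · rw [mem_union, not_or] at haY
              by_cases haW : a ∈ W
              · have := haY.1
                simp only [hS, hF, mem_filter, haW, true_and] at this ⊢
                exact this
              · exact absurd (mem_filter.2 ⟨mem_univ _, haW, q, hql, ha, j, hjS, hjl, hjq⟩)
                  haY.2
        have h2 := (card_le_card h1).trans (card_union_le _ _)
        rw [hR.card_pivot q hql, card_erase_eq_ite] at h2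
        have h3 : l ∈ S ∨ l ∈ F := by
          simp only [hS, hF, mem_filter, hl, true_and]
          exact em _
        simp only [hw, hql, if_true]
        split_ifs at * <;> first | omega | simp_all
    · have h1 : #((S ∪ O).erase q.1) ≤ #(R q ∩ (S ∪ O)) := card_le_card fun a ha =>
        mem_inter.2 ⟨hYmem q hqW hql ha, mem_of_mem_erase ha⟩
      have h2 : q.1 ∉ O := fun h => (mem_filter.1 h).2.1 hqW
      rw [card_erase_eq_ite] at h1
      simp only [mem_union, h2, or_false] at h1
      simp only [hw, hql, if_false]
      split_ifs at * <;> omega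
  have hsum : ∑ i ∈ W, m i * kp ≤
      ∑ i ∈ W, ∑ k : Fin (m i), #(R ⟨i, k⟩ ∩ (S ∪ O)) + ∑ i ∈ W, m i * w i := by
    rw [← sum_add_distrib]
    refine sum_le_sum fun i hi => ?_
    have := sum_le_sum fun (k : Fin (m i)) (_ : k ∈ univ) => hpaper ⟨i, k⟩ hi
    simpa [sum_add_distrib] using this
  have hY := sum_load_on R W (S ∪ O)
  rw [sum_union hSO] at hY
  have hOload : ∑ a ∈ O, load R a ≤ #O * ka := by
    refine sum_le_card_nsmul O _ ka fun a ha => ?_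
    have := hR.load_out a (mem_filter.1 ha).2.1
    have := hm a
    simp at *
    omega
  have hFload : ∑ a ∈ F, load R a = #F * ka := by
    refine sum_const_nat fun a ha => ?_
    have h1 := hR.load_in a (mem_filter.1 ha).1
    have h2 := (mem_filter.1 ha).2
    simp at *
    omega
  have hWload := sum_load_lt hR hp
  rw [← sum_filter_add_sum_filter_not W (fun a => load R a < ka), ← hS, ← hF, hFload]
    at hWload
  have hsumw : ∑ i ∈ W, w i = kp * (e + 1) := by
    simp only [hw, sum_add_distrib, sum_const, hW, smul_eq_mul]
    rw [← card_filter, filter_mem_eq_inter, inter_eq_right.2 hSW, sum_ite_eq' W l, if_pos hl]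
    have : #S + #O + e = kp := by omega
    linarith
  have hmw : kp * ∑ i ∈ W, m i * w i ≤ ka * (kp * (e + 1)) := by
    rw [← hsumw, mul_sum, mul_sum]
    refine sum_le_sum fun i _ => ?_
    calc kp * (m i * w i) = (m i * kp) * w i := by ring
      _ ≤ ka * w i := Nat.mul_le_mul_right _ (hm i)
  have hlt : (e + 1) * ka < ∑ i ∈ W, m i * w i := by
    rw [he] at hWload
    linarith
  have := Nat.mul_lt_mul_of_pos_left hlt hkp
  linarith

end Filling

section Trading

variable {kp : ℕ} {u : ∀ i : Fin n, Fin (m i) → Fin n → ℝ} {R : Assign n m} {U : Finset (Fin n)}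

lemma received_eq (R : Assign n m) (a : Fin n) :
    received R a = ∑ p : Paper n m, if p.1 = a then #(R p) else 0 := by
  rw [Fintype.sum_sigma, sum_eq_single a (by simp +contextual) (by simp)]
  simp [received]

/-- On each of her papers, agent `i` likes every reviewer at least as much as every other agent
of `X`. -/
def Favors (u : ∀ i : Fin n, Fin (m i) → Fin n → ℝ) (R : Assign n m) (i : Fin n)
    (X : Finset (Fin n)) : Prop :=
  ∀ p : Paper n m, p.1 = i → ∀ r ∈ R p, ∀ b ∈ X, b ≠ i → b ∉ R p → u p.1 p.2 b ≤ u p.1 p.2 r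

lemma Favors.mono {i : Fin n} {X Y : Finset (Fin n)} (h : Favors u R i Y) (hXY : X ⊆ Y) :
    Favors u R i X :=
  fun p hp r hr b hb => h p hp r hr b (hXY hb)

/-- A state of the top trading cycles procedure with active agents `U`. -/
structure IsTradingState (kp : ℕ) (u : ∀ i : Fin n, Fin (m i) → Fin n → ℝ) (R : Assign n m)
    (U : Finset (Fin n)) : Prop where
  card_le : ∀ p, #(R p) ≤ kp
  not_own : ∀ p, p.1 ∉ R p
  balanced : ∀ a, load R a = received R a
  complete : ∀ p, p.1 ∉ U → #(R p) = kp
  favors : ∀ i ∈ U, Favors u R i U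
  exists_favors : ∀ X, ¬ X ⊆ U → ∃ i ∈ X, i ∉ U ∧ Favors u R i X

lemma isTradingState_empty : IsTradingState kp u (fun _ => ∅) univ where
  card_le := by simp
  not_own := by simp
  balanced := by simp [load, received]
  complete := by simp
  favors := by simp [Favors]
  exists_favors X hX := absurd (subset_univ X) hX

lemma IsTradingState.erase (h : IsTradingState kp u R U) {i : Fin n}
    (hc : ∀ p : Paper n m, p.1 = i → #(R p) = kp) : IsTradingState kp u R (U.erase i) where
  card_le := h.card_le
  not_own := h.not_own
  balanced := h.balanced
  complete p hp := by
    by_cases e : p.1 = i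
    · exact hc p e
    · exact h.complete p fun hU => hp (mem_erase.2 ⟨e, hU⟩)
  favors j hj := (h.favors j (mem_of_mem_erase hj)).mono (erase_subset _ _)
  exists_favors X hX := by
    by_cases hXU : X ⊆ U
    · obtain ⟨j, hj, hjU⟩ := not_subset.1 hX
      exact ⟨j, hj, hjU, (h.favors j (hXU hj)).mono hXU⟩
    · obtain ⟨j, hj, hjU, hf⟩ := h.exists_favors X hXU
      exact ⟨j, hj, fun e => hjU (mem_of_mem_erase e), hf⟩

/-- A self-map of a nonempty finite set permutes some nonempty subset. -/
lemma exists_image_eq {α : Type*} [DecidableEq α] {U : Finset α} (hU : U.Nonempty) {f : α → α}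
    (hf : ∀ i ∈ U, f i ∈ U) : ∃ C ⊆ U, C.Nonempty ∧ C.image f = C := by
  obtain ⟨C, hC, hmin⟩ := exists_min_image
    (U.powerset.filter fun C => C.Nonempty ∧ C.image f ⊆ C) card
    ⟨U, by simpa [hU, image_subset_iff] using hf⟩
  simp only [mem_filter, mem_powerset] at hC hmin
  refine ⟨C, hC.1, hC.2.1, eq_of_subset_of_card_le hC.2.2 ?_⟩
  exact hmin _ ⟨hC.2.2.trans hC.1, hC.2.1.image f, image_subset_image hC.2.2⟩

lemma sum_ite_eq_of_image_eq {α : Type*} [DecidableEq α] {C : Finset α} {f : α → α}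
    (hf : C.image f = C) (a : α) :
    ∑ i ∈ C, (if f i = a then 1 else 0) = if a ∈ C then 1 else 0 := by
  have hinj : Set.InjOn f C := card_image_iff.1 (congrArg card hf)
  rw [← sum_image (f := fun x => if x = a then 1 else 0) hinj, hf, sum_ite_eq']

/-- If all active agents have incomplete papers, some trading cycle can be carried out. -/
lemma IsTradingState.trade (h : IsTradingState kp u R U) (hU : kp + 1 ≤ #U)
    (hinc : ∀ i ∈ U, ∃ p : Paper n m, p.1 = i ∧ #(R p) < kp) :
    ∃ R', IsTradingState kp u R' U ∧ size R < size R' := by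
  have hne : U.Nonempty := card_pos.1 (by omega)
  have key : ∀ i ∈ U, ∃ p : Paper n m, ∃ b : Fin n, p.1 = i ∧ #(R p) < kp ∧ b ∈ U ∧ b ≠ i ∧
      b ∉ R p ∧ ∀ c ∈ U, c ≠ i → c ∉ R p → u p.1 p.2 c ≤ u p.1 p.2 b := by
    intro i hi
    obtain ⟨p, hpi, hp⟩ := hinc i hi
    have hpos : (U.erase i \ R p).Nonempty := by
      rw [← card_pos]
      have h1 := le_card_sdiff (R p) (U.erase i)
      have h2 := card_erase_of_mem hi
      omega
    obtain ⟨b, hb, hmax⟩ := exists_max_image _ (u p.1 p.2) hpos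
    simp only [mem_sdiff, mem_erase] at hb hmax
    exact ⟨p, b, hpi, hp, hb.1.2, hb.1.1, hb.2, fun c hc hci hcR => hmax c ⟨⟨hci, hc⟩, hcR⟩⟩
  obtain ⟨i₀, hi₀⟩ := hne
  have : Nonempty (Paper n m) := ⟨(key i₀ hi₀).choose⟩
  have : Nonempty (Fin n) := ⟨i₀⟩
  choose! g f hg hgc hfU hfi hfR hfmax using key
  obtain ⟨C, hCU, hCne, hC⟩ := exists_image_eq ⟨i₀, hi₀⟩ hfU
  set D := C.image g with hD
  have hDC : ∀ p ∈ D, p.1 ∈ C ∧ g p.1 = p := by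
    intro p hp
    obtain ⟨i, hi, rfl⟩ := mem_image.1 hp
    rw [hg i (hCU hi)]
    exact ⟨hi, rfl⟩
  have hginj : Set.InjOn g C := fun i hi j hj e => by
    rw [← hg i (hCU hi), ← hg j (hCU hj), e]
  have hDR : ∀ p ∈ D, f p.1 ∉ R p ∧ #(R p) < kp ∧ f p.1 ≠ p.1 := by
    intro p hp
    obtain ⟨hpC, hgp⟩ := hDC p hp
    have h1 := hfR _ (hCU hpC)
    have h2 := hgc _ (hCU hpC)
    rw [hgp] at h1 h2
    exact ⟨h1, h2, hfi _ (hCU hpC)⟩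
  have hDsum : ∀ φ : Fin n → ℕ,
      ∑ p : Paper n m, (if p ∈ D then φ p.1 else 0) = ∑ i ∈ C, φ i := by
    intro φ
    rw [← sum_filter, filter_mem_eq_inter, univ_inter, hD, sum_image hginj]
    exact sum_congr rfl fun i hi => by rw [hg i (hCU hi)]
  set R' : Assign n m := fun p => if p ∈ D then insert (f p.1) (R p) else R p with hR'
  have hin : ∀ p ∈ D, R' p = insert (f p.1) (R p) := fun p hp => if_pos hp
  have hout : ∀ p, p ∉ D → R' p = R p := fun p hp => if_neg hp
  have hload : ∀ a, load R' a = load R a + if a ∈ C then 1 else 0 := by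
    intro a
    rw [← sum_ite_eq_of_image_eq hC a, ← hDsum (fun i => if f i = a then 1 else 0)]
    unfold load
    rw [← sum_add_distrib]
    refine sum_congr rfl fun p _ => ?_
    by_cases hp : p ∈ D
    · have := (hDR p hp).1
      rw [hin p hp, if_pos hp]
      simp only [mem_insert]
      by_cases e : f p.1 = a
      · subst e; simp [this]
      · simp [e, Ne.symm e]
    · simp [hout p hp, hp]
  have hreceived : ∀ a, received R' a = received R a + if a ∈ C then 1 else 0 := by
    intro a
    rw [← sum_ite_eq' C a (fun _ => 1), ← hDsum (fun i => if i = a then 1 else 0),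
      received_eq, received_eq, ← sum_add_distrib]
    refine sum_congr rfl fun p _ => ?_
    by_cases hp : p ∈ D
    · rw [hin p hp, if_pos hp, card_insert_of_notMem (hDR p hp).1]
      split_ifs <;> rfl
    · simp [hout p hp, hp]
  have hCout : ∀ p : Paper n m, p.1 ∉ U → R' p = R p := fun p hp =>
    hout p fun hpD => hp (hCU (hDC p hpD).1)
  refine ⟨R', ⟨?_, ?_, ?_, ?_, ?_, ?_⟩, ?_⟩
  · intro p
    by_cases hp : p ∈ D
    · rw [hin p hp, card_insert_of_notMem (hDR p hp).1]
      exact (hDR p hp).2.1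
    · rw [hout p hp]; exact h.card_le p
  · intro p
    by_cases hp : p ∈ D
    · rw [hin p hp, mem_insert, not_or]
      exact ⟨(hDR p hp).2.2.symm, h.not_own p⟩
    · rw [hout p hp]; exact h.not_own p
  · intro a
    rw [hload, hreceived, h.balanced]
  · intro p hp
    rw [hCout p hp]; exact h.complete p hp
  · intro i hi p hpi r hr b hb hbi hbR
    by_cases hp : p ∈ D
    · rw [hin p hp, mem_insert] at hr
      rw [hin p hp, mem_insert, not_or] at hbR
      rcases hr with rfl | hr
      · have := hfmax p.1 (hpi ▸ hi) b hb (hpi ▸ hbi)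
        rw [(hDC p hp).2] at this
        exact this hbR.2
      · exact h.favors i hi p hpi r hr b hb hbi hbR.2
    · rw [hout p hp] at hr hbR
      exact h.favors i hi p hpi r hr b hb hbi hbR
  · intro X hX
    obtain ⟨i, hiX, hiU, hi⟩ := h.exists_favors X hX
    refine ⟨i, hiX, hiU, fun p hpi => ?_⟩
    rw [hCout p (hpi ▸ hiU)]
    exact hi p hpi
  · rw [← sum_load R, ← sum_load R']
    obtain ⟨a, ha⟩ := hCne
    refine sum_lt_sum (fun b _ => ?_) ⟨a, mem_univ _, ?_⟩
    · rw [hload]; exact Nat.le_add_right _ _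
    · rw [hload, if_pos ha]; exact Nat.lt_succ_self _

/-- Trading can be run until `kp + 1` agents are active, one of them with complete papers. -/
lemma exists_isTradingState (kp : ℕ) (hn : kp + 1 ≤ n)
    (u : ∀ i : Fin n, Fin (m i) → Fin n → ℝ) :
    ∃ (R : Assign n m) (U : Finset (Fin n)), IsTradingState kp u R U ∧ #U = kp + 1 ∧
      ∃ l ∈ U, ∀ p : Paper n m, p.1 = l → #(R p) = kp := by
  classical
  let Q : ℕ → Prop := fun N => ∃ (R : Assign n m) (U : Finset (Fin n)),
    IsTradingState kp u R U ∧ kp + 1 ≤ #U ∧ size R + (n - #U) = N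
  have hQ0 : Q (Nat.findGreatest Q (Fintype.card (Paper n m) * kp + n)) := by
    refine Nat.findGreatest_spec (P := Q) (m := 0) (Nat.zero_le _)
      ⟨_, _, isTradingState_empty, by simpa using hn, ?_⟩
    simp [size]
  obtain ⟨R, U, hRU, hU, hN⟩ := hQ0
  have hmax : ∀ (R' : Assign n m) (U' : Finset (Fin n)), IsTradingState kp u R' U' →
      kp + 1 ≤ #U' → size R' + (n - #U') ≤ size R + (n - #U) := by
    intro R' U' h' hU'
    rw [hN]
    refine Nat.le_findGreatest ?_ ⟨R', U', h', hU', rfl⟩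
    have := size_le h'.card_le
    omega
  have hex : ∃ l ∈ U, ∀ p : Paper n m, p.1 = l → #(R p) = kp := by
    by_contra! hno
    obtain ⟨R', h', hlt⟩ := hRU.trade hU fun i hi =>
      (hno i hi).imp fun p hp => ⟨hp.1, lt_of_le_of_ne (hRU.card_le p) hp.2⟩
    have := hmax R' U h' hU
    omega
  refine ⟨R, U, hRU, le_antisymm (not_lt.1 fun hlt => ?_) hU, hex⟩
  obtain ⟨l, hl, hc⟩ := hex
  have h1 := card_erase_of_mem hl
  have h2 := hmax R (U.erase l) (hRU.erase hc) (by omega)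
  have h3 : #U ≤ n := by simpa using card_le_univ U
  omega

end Trading

/-- Exchanging elements for other ones that are not better does not increase a sum. -/
lemma sum_le_sum_of_card_eq {α : Type*} [DecidableEq α] {A B : Finset α} (v : α → ℝ)
    (hcard : #A = #B) (h : ∀ a ∈ A, a ∉ B → ∀ b ∈ B, b ∉ A → v b ≤ v a) :
    ∑ b ∈ B, v b ≤ ∑ a ∈ A, v a := by
  rw [← sum_inter_add_sum_sdiff B A v, ← sum_inter_add_sum_sdiff A B v, inter_comm]
  have hs : #(A \ B) = #(B \ A) := card_sdiff_comm hcard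
  have e := equivOfCardEq hs
  have : ∑ b ∈ B \ A, v b ≤ ∑ a ∈ A \ B, v a := by
    rw [← sum_coe_sort (A \ B), ← sum_coe_sort (B \ A), ← Equiv.sum_comp e]
    refine sum_le_sum fun a _ => ?_
    have ha := mem_sdiff.1 a.2
    have hb := mem_sdiff.1 (e a).2
    exact h _ ha.1 ha.2 _ hb.1 hb.2
  linarith

/-- An agent who weakly prefers `R` to `R'` on every paper of `s` does not gain by moving to the
papers of `s` reviewed according to `R'`. -/
lemma utility_le {u : ∀ i : Fin n, Fin (m i) → Fin n → ℝ} {R R' : Assign n m} {i : Fin n}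
    (hu0 : ∀ (k : Fin (m i)) (a : Fin n), a ≠ i → 0 ≤ u i k a) (hR : ∀ p, p.1 ∉ R p)
    {s : Finset (Fin (m i))}
    (hcard : ∀ k ∈ s, #(R ⟨i, k⟩) = #(R' ⟨i, k⟩))
    (h : ∀ k ∈ s, ∀ a ∈ R ⟨i, k⟩, a ∉ R' ⟨i, k⟩ → ∀ b ∈ R' ⟨i, k⟩, b ∉ R ⟨i, k⟩ →
      u i k b ≤ u i k a) :
    ∑ k ∈ s, ∑ r ∈ R' ⟨i, k⟩, u i k r ≤ ∑ k, ∑ r ∈ R ⟨i, k⟩, u i k r := by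
  refine (sum_le_sum fun k hk => sum_le_sum_of_card_eq (u i k) (hcard k hk) (h k hk)).trans
    (sum_le_univ_sum_of_nonneg fun k => sum_nonneg fun r hr => hu0 k r ?_)
  rintro rfl
  exact hR ⟨_, k⟩ hr

end CoreAssignment

/-- With injective nonnegative similarity scores `u i ℓ` over the
potential reviewers of each submission, there is a valid assignment `R` such that no
community `N'` (with paper subsets `P'`) can deviate to a valid restricted assignment
giving every one of its members strictly larger additive utility. -/
theorem exists_core_assignment_additive
    (n kp ka : ℕ) (m : Fin n → ℕ)
    (hkp : 1 ≤ kp) (hn : kp + 1 ≤ n) (hm : ∀ i : Fin n, m i * kp ≤ ka)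
    (u : ∀ i : Fin n, Fin (m i) → Fin n → ℝ)
    (hu0 : ∀ (i : Fin n) (ℓ : Fin (m i)) (a : Fin n), a ≠ i → 0 ≤ u i ℓ a)
    (huinj : ∀ (i : Fin n) (ℓ : Fin (m i)) (a b : Fin n),
        a ≠ i → b ≠ i → u i ℓ a = u i ℓ b → a = b) :
    ∃ R : Assign n m, ValidAssignment n m kp ka R ∧
      ¬ ∃ (N' : Finset (Fin n)) (P' : ∀ i : Fin n, Finset (Fin (m i)))
          (Rhat : Assign n m),
          N'.Nonempty ∧ ValidRestricted n m kp ka N' P' Rhat ∧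
          ∀ i ∈ N',
            (∑ ℓ : Fin (m i), ∑ r ∈ R ⟨i, ℓ⟩, u i ℓ r) <
            (∑ ℓ ∈ P' i, ∑ r ∈ Rhat ⟨i, ℓ⟩, u i ℓ r) := by
  classical
  obtain ⟨T, W, hT, hW, l, hl, hTl⟩ := CoreAssignment.exists_isTradingState kp hn u
  let Q : ℕ → Prop := fun N => ∃ R : Assign n m,
    CoreAssignment.IsFilling kp ka T W l 0 R ∧ CoreAssignment.size R = N
  have hload : ∀ a, CoreAssignment.load T a ≤ m a * kp := fun a => by
    rw [hT.balanced]
    simpa [CoreAssignment.received] using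
      Finset.sum_le_sum fun (k : Fin (m a)) (_ : k ∈ Finset.univ) => hT.card_le ⟨a, k⟩
  have hTfill : CoreAssignment.IsFilling kp ka T W l 0 T :=
    { card_le := hT.card_le
      not_own := hT.not_own
      outside := fun _ _ => rfl
      card_pivot := hTl
      pivot_sub := fun _ _ => Finset.subset_union_left
      pivot_sup := fun _ _ => Finset.inter_subset_left
      load_out := fun a ha => by
        rw [hT.balanced, CoreAssignment.received,
          Finset.sum_congr rfl fun k _ => hT.complete ⟨a, k⟩ ha]
        simp
      load_in := fun a _ => (hload a).trans (hm a) }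
  have hbound : ∀ R, CoreAssignment.IsFilling kp ka T W l 0 R →
      CoreAssignment.size R ≤ Fintype.card (Paper n m) * kp :=
    fun R hR => CoreAssignment.size_le hR.card_le
  obtain ⟨R, hR, hN⟩ := Nat.findGreatest_spec (P := Q) (hbound T hTfill) ⟨T, hTfill, rfl⟩
  have hfull : ∀ p, (R p).card = kp := hR.card_eq_of_maximal hkp hm hW hl hT.complete
    fun R' hR' => hN ▸ Nat.le_findGreatest (hbound R' hR') ⟨R', hR', rfl⟩
  refine ⟨R, ⟨hfull, fun i => ?_, hR.not_own⟩, ?_⟩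
  · rw [Finset.card_filter]
    by_cases hi : i ∈ W
    · exact hR.load_in i hi
    · exact (hR.load_out i hi).le.trans (hm i)
  rintro ⟨N', P', Rhat, ⟨i₀, hi₀⟩, ⟨hcard, -⟩, hgain⟩
  have hnot : ∀ i ∈ N', ¬ ∀ k ∈ P' i, ∀ a ∈ R ⟨i, k⟩, a ∉ Rhat ⟨i, k⟩ → ∀ b ∈ Rhat ⟨i, k⟩,
      b ∉ R ⟨i, k⟩ → u i k b ≤ u i k a := fun i hi h =>
    (hgain i hi).not_ge <| CoreAssignment.utility_le (hu0 i) hR.not_own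
      (fun k hk => (hfull _).trans (hcard ⟨i, k⟩ hi hk).1.symm) h
  by_cases hsub : N' ⊆ W
  · obtain ⟨k₀, hk₀⟩ : (P' i₀).Nonempty := by
      by_contra h
      rw [Finset.not_nonempty_iff_eq_empty] at h
      exact hnot i₀ hi₀ (by simp [h])
    obtain ⟨hc, hs, ho⟩ := hcard ⟨i₀, k₀⟩ hi₀ hk₀
    have hNW : N' = W := by
      refine Finset.eq_of_subset_of_card_le hsub ?_
      rw [hW, ← hc, ← Finset.card_insert_of_notMem ho]
      exact Finset.card_le_card (Finset.insert_subset hi₀ hs)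
    have hlN : l ∈ N' := hNW ▸ hl
    refine hnot l hlN fun k hk a ha haR b hb hbR => ?_
    obtain ⟨hc, hs, ho⟩ := hcard ⟨l, k⟩ hlN hk
    have hRhat : Rhat ⟨l, k⟩ = W.erase l := by
      refine Finset.eq_of_subset_of_card_le
        (fun x hx => Finset.mem_erase.2 ⟨fun e => ho (e ▸ hx), hsub (hs hx)⟩) ?_
      rw [Finset.card_erase_of_mem hl, hW, hc, Nat.add_sub_cancel]
    rw [hRhat] at haR hb
    obtain ⟨hbl, hbW⟩ := Finset.mem_erase.1 hb
    have haW : a ∉ W := fun h => haR (Finset.mem_erase.2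
      ⟨fun e => hR.not_own ⟨l, k⟩ (e ▸ ha), h⟩)
    have haT : a ∈ T ⟨l, k⟩ :=
      (Finset.mem_union.1 (hR.pivot_sub ⟨l, k⟩ rfl ha)).resolve_right haW
    exact hT.favors l hl ⟨l, k⟩ rfl a haT b hbW hbl fun h =>
      hbR (hR.pivot_sup ⟨l, k⟩ rfl (Finset.mem_inter.2 ⟨h, hbW⟩))
  · obtain ⟨i, hi, hiW, hf⟩ := hT.exists_favors N' hsub
    refine hnot i hi fun k hk a ha _ b hb hbR => ?_
    obtain ⟨-, hs, ho⟩ := hcard ⟨i, k⟩ hi hk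
    rw [hR.outside ⟨i, k⟩ hiW] at ha hbR
    exact hf ⟨i, k⟩ rfl a ha b (hs hb) (fun e => ho (e ▸ hb)) hbR
end

section
/- Suppose there are n agents, each agent i authoring m_i papers, with m_i · k_p ≤ k_a for every agent i and n ≥ k_p + 1, where k_p ≥ 1. Then a valid assignment exists: there is an assignment of reviewers to papers in which every paper is assigned exactly k_p reviewers, every agent is assigned at most k_a papers, and no agent is assigned any of her own papers. -/
/-- If `m i * kp ≤ ka` for every agent `i`, `n ≥ kp + 1` and
`kp ≥ 1`, then a valid assignment exists. -/
theorem exists_valid_assignment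
    (n kp ka : ℕ) (m : Fin n → ℕ)
    (hkp : 1 ≤ kp) (hn : kp + 1 ≤ n) (hm : ∀ i : Fin n, m i * kp ≤ ka) :
    ∃ R : Assign n m, ValidAssignment n m kp ka R := by
  obtain ⟨N, rfl⟩ : ∃ N, n = N + 1 := ⟨n - 1, by omega⟩
  obtain ⟨S, hS, hcard⟩ := Finset.exists_subset_card_eq
    (s := (Finset.univ : Finset (Fin (N + 1))).erase 0) (n := kp) (by simp; omega)
  have h0 : (0 : Fin (N + 1)) ∉ S := fun h => by simpa using hS h
  refine ⟨fun p => S.map (addLeftEmbedding p.1), fun p => by simpa using hcard, fun i => ?_,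
    fun p => by simpa using h0⟩
  have hmem (j : Fin (N + 1)) : i ∈ S.map (addLeftEmbedding j) ↔ j ∈ S.image (fun s => i - s) := by
    simp only [Finset.mem_map, addLeftEmbedding_apply, Finset.mem_image, sub_eq_iff_eq_add]
    exact ⟨fun ⟨s, hs, h⟩ => ⟨s, hs, h.symm⟩, fun ⟨s, hs, h⟩ => ⟨s, hs, h.symm⟩⟩
  have himage : (S.image (fun s => i - s)).card = kp := by
    rw [Finset.card_image_of_injective _ sub_right_injective, hcard]
  have hfilter : (Finset.univ : Finset (Paper (N + 1) m)).filter
      (fun p => i ∈ S.map (addLeftEmbedding p.1)) =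
        (S.image (fun s => i - s)).sigma (fun _ => Finset.univ) := by
    ext p
    simp only [Finset.mem_filter, Finset.mem_univ, true_and, Finset.mem_sigma, and_true, hmem]
  rw [hfilter, Finset.card_sigma]
  simp only [Finset.card_univ, Fintype.card_fin]
  refine Nat.le_of_mul_le_mul_right ?_ hkp
  calc (∑ j ∈ S.image (fun s => i - s), m j) * kp
      = ∑ j ∈ S.image (fun s => i - s), m j * kp := Finset.sum_mul ..
    _ ≤ (S.image (fun s => i - s)).card • ka := Finset.sum_le_card_nsmul _ _ _ fun j _ => hm j
    _ = ka * kp := by rw [himage, smul_eq_mul, mul_comm]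
end

section
/- Let R be a partial assignment in which every paper is assigned at most k_p reviewers, let agent j have exactly m* papers and satisfy the invariant |R^a_j| = Σ_{ℓ∈[m*]} |R^p_{p_{j,ℓ}}|, and let S be a set of k_p agents not containing j, each authoring exactly m* papers. If agent j reviews all papers of all agents in S, then |R^a_j| ≥ k_p · m*, and hence every paper of agent j is completely assigned (assigned exactly k_p reviewers). -/
/-- Suppose every paper has at most `kp` reviewers, agent `j` has
exactly `mstar` papers, `j`'s review load equals the total number of reviewers
assigned to her own papers, and `S` is a set of `kp` agents not containing `j`, each
authoring exactly `mstar` papers.  If `j` reviews all papers of all agents in `S`,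
then `j` reviews at least `kp * mstar` papers, and hence every paper of `j` is
completely assigned (has exactly `kp` reviewers). -/
theorem reviews_all_implies_completely_assigned
    (n kp ka mstar : ℕ) (m : Fin n → ℕ) (R : Assign n m)
    (hub : ∀ p : Paper n m, (R p).card ≤ kp)
    (j : Fin n) (hmj : m j = mstar)
    (hinv : ((Finset.univ : Finset (Paper n m)).filter (fun p => j ∈ R p)).card
          = ∑ ℓ : Fin (m j), (R ⟨j, ℓ⟩).card)
    (S : Finset (Fin n)) (hScard : S.card = kp) (hjS : j ∉ S)
    (hmS : ∀ i ∈ S, m i = mstar)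
    (hrev : ∀ p : Paper n m, p.1 ∈ S → j ∈ R p) :
    kp * mstar ≤ ((Finset.univ : Finset (Paper n m)).filter (fun p => j ∈ R p)).card ∧
    ∀ ℓ : Fin (m j), (R ⟨j, ℓ⟩).card = kp := by
  have hload : kp * mstar ≤
      ((Finset.univ : Finset (Paper n m)).filter (fun p => j ∈ R p)).card := by
    have hcard : (S.sigma fun i => (Finset.univ : Finset (Fin (m i)))).card = kp * mstar := by
      rw [Finset.card_sigma, ← hScard, ← smul_eq_mul, ← Finset.sum_const]
      exact Finset.sum_congr rfl fun i hi => by simp [hmS i hi]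
    rw [← hcard]
    refine Finset.card_le_card fun p hp => ?_
    exact Finset.mem_filter.2 ⟨Finset.mem_univ p, hrev p (Finset.mem_sigma.1 hp).1⟩
  refine ⟨hload, fun ℓ => ?_⟩
  have hle : ∀ ℓ ∈ (Finset.univ : Finset (Fin (m j))), (R ⟨j, ℓ⟩).card ≤ kp :=
    fun ℓ _ => hub ⟨j, ℓ⟩
  have hsum : ∑ ℓ : Fin (m j), (R ⟨j, ℓ⟩).card = ∑ _ℓ : Fin (m j), kp := by
    refine le_antisymm (Finset.sum_le_sum hle) ?_
    rw [← hinv, Finset.sum_const, Finset.card_univ, Fintype.card_fin, smul_eq_mul, hmj, mul_comm]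
    exact hload
  exact (Finset.sum_eq_sum_iff_of_le hle).1 hsum ℓ (Finset.mem_univ ℓ)
end
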